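/- arXiv:1104.0823 — 4 statements merged into one kernel-verified Lean document; each statement's English description precedes it below -/
import Mathlib

section
/- Let q, z be complex numbers with q ≠ 0, z ≠ 0, and let n ≥ 0 and l, m be integers with 0 ≤ l ≤ n and 0 ≤ m ≤ n. Assume q^j ≠ 1 for all 1 ≤ j ≤ n, and z·q^{k-m} ≠ 1 for all 0 ≤ k ≤ n-1. Then ∑_{k=0, k≠m}^{n} [n choose k]_q · (q/z;q)_k · (z·q^{-l};q)_{n-k} · z^k / (1 - q^{k-m}) = (-1)^m · q^{m(m+1)/2} · [n choose m]_q · (z·q^{-l};q)_l · (z·q^{-m};q)_{n-l} · ( ∑_{k=0}^{n-l-1} z·q^{k-m}/(1 - z·q^{k-m}) − ∑_{k=0, k≠m}^{n} q^{k-m}/(1 - q^{k-m}) ). -/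
open Finset

/-- The q-Pochhammer symbol `(x;q)_N = ∏_{j=0}^{N-1} (1 - x q^j)`. -/
noncomputable def qPoch (q x : ℂ) (N : ℕ) : ℂ := ∏ j ∈ Finset.range N, (1 - x * q ^ j)

/-- The Gaussian binomial coefficient `[n choose k]_q = (q;q)_n / ((q;q)_k (q;q)_{n-k})`. -/
noncomputable def qBinom (q : ℂ) (n k : ℕ) : ℂ := qPoch q q n / (qPoch q q k * qPoch q q (n - k))

open Polynomial in
lemma eval_derivative_prod_one_sub {ι K : Type*} [Field K] (s : Finset ι) (a : ι → K) (x : K)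
    (h : ∀ j ∈ s, 1 - a j * x ≠ 0) :
    (derivative (∏ j ∈ s, (1 - C (a j) * X))).eval x
      = -((∏ j ∈ s, (1 - a j * x)) * ∑ j ∈ s, a j / (1 - a j * x)) := by
  classical
  induction s using Finset.induction_on with
  | empty => simp
  | insert i s hi ih =>
    have hix := h i (mem_insert_self i s)
    rw [prod_insert hi, prod_insert hi, sum_insert hi, derivative_mul, eval_add, eval_mul, eval_mul,
      ih fun j hj => h j (mem_insert_of_mem hj)]
    have hcancel := mul_div_cancel₀ (a i) hix
    simp [eval_prod]
    linear_combination (∏ j ∈ s, (1 - a j * x)) * hcancel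

open Polynomial in
lemma natDegree_prod_one_sub_le {ι K : Type*} [Field K] (s : Finset ι) (a : ι → K) :
    (∏ j ∈ s, (1 - C (a j) * X)).natDegree ≤ #s := by
  refine (natDegree_prod_le _ _).trans ((sum_le_card_nsmul _ _ 1 fun j _ => ?_).trans (by simp))
  compute_degree

open Polynomial in
/-- Partial fractions: a polynomial of degree less than the number of nodes `(a k)⁻¹` is recovered
from its values there. -/
lemma eq_sum_prod_one_sub {ι K : Type*} [DecidableEq ι] [Field K] (s : Finset ι) (a A : ι → K)
    (ha : ∀ j ∈ s, a j ≠ 0) (hinj : Set.InjOn a s) (P : K[X]) (hP : P.degree < #s)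
    (hA : ∀ k ∈ s, A k * ∏ j ∈ s.erase k, (1 - a j * (a k)⁻¹) = P.eval (a k)⁻¹) :
    P = ∑ k ∈ s, C (A k) * ∏ j ∈ s.erase k, (1 - C (a j) * X) := by
  refine eq_of_degrees_lt_of_eval_index_eq s (v := fun k => (a k)⁻¹)
    (fun i hi j hj hij => hinj hi hj (inv_injective hij)) hP ?_ fun k hk => ?_
  · refine (degree_sum_le _ _).trans_lt ((Finset.sup_lt_iff (WithBot.bot_lt_coe _)).2 fun k hk => ?_)
    refine degree_le_natDegree.trans_lt (Nat.cast_lt.2 ?_)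
    calc _ ≤ _ := natDegree_C_mul_le _ _
      _ ≤ _ := natDegree_prod_one_sub_le _ _
      _ < _ := card_erase_lt_of_mem hk
  · rw [← hA k hk, eval_finsetSum, sum_eq_single_of_mem k hk]
    · simp [eval_prod]
    · intro i hi hik
      rw [eval_mul, eval_prod, prod_eq_zero (mem_erase.2 ⟨hik.symm, hk⟩), mul_zero]
      simp [ha k hk]

open Polynomial in
/-- The finite part of the partial fraction expansion at one of its poles. -/
lemma sum_erase_div_one_sub {ι κ K : Type*} [DecidableEq ι] [Field K] (s : Finset ι) (t : Finset κ)
    (a A : ι → K) (b : κ → K) (c : K) (ha : ∀ j ∈ s, a j ≠ 0) (hinj : Set.InjOn a s)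
    (hts : #t < #s)
    (hA : ∀ k ∈ s, A k * ∏ j ∈ s.erase k, (1 - a j * (a k)⁻¹)
      = c * ∏ j ∈ t, (1 - b j * (a k)⁻¹))
    {m : ι} (hm : m ∈ s) (hb : ∀ j ∈ t, 1 - b j * (a m)⁻¹ ≠ 0) :
    ∑ k ∈ s.erase m, A k / (1 - a k * (a m)⁻¹)
      = A m * ((∑ j ∈ t, b j * (a m)⁻¹ / (1 - b j * (a m)⁻¹))
        - ∑ k ∈ s.erase m, a k * (a m)⁻¹ / (1 - a k * (a m)⁻¹)) := by
  have ham := ha m hm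
  have hne : ∀ j ∈ s.erase m, 1 - a j * (a m)⁻¹ ≠ 0 := by
    intro j hj h
    refine (mem_erase.1 hj).1 (hinj (mem_of_mem_erase hj) hm ?_)
    field_simp at h
    linear_combination -h
  have hD : ∏ j ∈ s.erase m, (1 - a j * (a m)⁻¹) ≠ 0 := prod_ne_zero_iff.2 hne
  have key := eq_sum_prod_one_sub s a A ha hinj (C c * ∏ j ∈ t, (1 - C (b j) * X))
    (degree_le_natDegree.trans_lt (Nat.cast_lt.2 (((natDegree_C_mul_le _ _).trans
      (natDegree_prod_one_sub_le _ _)).trans_lt hts)))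
    (fun k hk => by simpa [eval_prod] using hA k hk)
  have hder := congrArg (fun p => (derivative p).eval (a m)⁻¹) key
  have hterm : ∀ k ∈ s.erase m,
      (derivative (C (A k) * ∏ j ∈ s.erase k, (1 - C (a j) * X))).eval (a m)⁻¹
        = -(a m * (∏ j ∈ s.erase m, (1 - a j * (a m)⁻¹))) * (A k / (1 - a k * (a m)⁻¹)) := by
    intro k hk
    have hmk : m ∈ s.erase k := mem_erase.2 ⟨(mem_erase.1 hk).1.symm, hm⟩
    rw [← mul_prod_erase _ _ hmk, ← mul_prod_erase _ _ hk, erase_right_comm]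
    have hcancel := mul_div_cancel₀ (A k) (hne k hk)
    simp [eval_prod, ham]
    linear_combination -a m * (∏ j ∈ (s.erase m).erase k, (1 - a j * (a m)⁻¹)) * hcancel
  simp only [derivative_sum, eval_finsetSum] at hder
  rw [← add_sum_erase _ _ hm, sum_congr rfl hterm, ← mul_sum, derivative_C_mul, derivative_C_mul,
    eval_C_mul, eval_C_mul, eval_derivative_prod_one_sub _ _ _ hb,
    eval_derivative_prod_one_sub _ _ _ hne] at hder
  simp only [mul_div_right_comm _ (a m)⁻¹, ← sum_mul]
  apply mul_left_cancel₀ (mul_ne_zero ham hD)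
  linear_combination hder - (∑ j ∈ t, b j / (1 - b j * (a m)⁻¹)) * hA m hm
    - (∏ j ∈ s.erase m, (1 - a j * (a m)⁻¹)) * A m
      * (∑ j ∈ t, b j / (1 - b j * (a m)⁻¹) - ∑ j ∈ s.erase m, a j / (1 - a j * (a m)⁻¹))
      * mul_inv_cancel₀ ham

lemma qPoch_add (q x : ℂ) (a b : ℕ) :
    qPoch q x (a + b) = qPoch q x a * qPoch q (x * q ^ a) b := by
  simp [qPoch, prod_range_add, pow_add, mul_assoc]

lemma qPoch_succ_left (q x : ℂ) (N : ℕ) : qPoch q x (N + 1) = (1 - x) * qPoch q (x * q) N := by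
  rw [add_comm, qPoch_add]
  simp [qPoch]

lemma qPoch_mul_zpow_neg {q z : ℂ} (hq : q ≠ 0) (hz : z ≠ 0) (k : ℕ) :
    (-1) ^ k * q ^ (k * (k + 1) / 2) * qPoch q (z * q ^ (-(k : ℤ))) k
      = qPoch q (q / z) k * z ^ k := by
  induction k with
  | zero => simp [qPoch]
  | succ k ih =>
    have hexp : (k + 1) * (k + 1 + 1) / 2 = k * (k + 1) / 2 + (k + 1) := by
      rw [show (k + 1) * (k + 1 + 1) = k * (k + 1) + 2 * (k + 1) by ring]
      omega
    have hbase : z * q ^ (-((k + 1 : ℕ) : ℤ)) * q = z * q ^ (-(k : ℤ)) := by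
      rw [mul_assoc, ← zpow_add_one₀ hq]
      congr 2
      push_cast
      ring
    have hlast : qPoch q (q / z) (k + 1) = qPoch q (q / z) k * (1 - q / z * q ^ k) :=
      prod_range_succ _ _
    rw [qPoch_succ_left, hbase, hlast, hexp, pow_add q, zpow_neg, zpow_natCast]
    have hone : (-1) * q ^ (k + 1) * (1 - z * (q ^ (k + 1))⁻¹) = (1 - q / z * q ^ k) * z := by
      field_simp
      ring
    linear_combination ((-1) * q ^ (k + 1) * (1 - z * (q ^ (k + 1))⁻¹)) * ih
      + qPoch q (q / z) k * z ^ k * hone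

lemma qPoch_mul_qPoch_swap {q : ℂ} (hq : q ≠ 0) (z : ℂ) {n k l : ℕ} (hk : k ≤ n) (hl : l ≤ n) :
    qPoch q (z * q ^ (-(k : ℤ))) k * qPoch q (z * q ^ (-(l : ℤ))) (n - k)
      = qPoch q (z * q ^ (-(l : ℤ))) l * qPoch q (z * q ^ (-(k : ℤ))) (n - l) := by
  rcases le_total (k + l) n with h | h
  · obtain ⟨r, rfl⟩ := Nat.exists_eq_add_of_le h
    rw [show k + l + r - k = l + r by omega, show k + l + r - l = k + r by omega,
      qPoch_add q _ l r, qPoch_add q _ k r]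
    have (i : ℕ) : z * q ^ (-(i : ℤ)) * q ^ i = z := by simp [hq]
    rw [this, this]
    ring
  · obtain ⟨u, rfl⟩ := Nat.exists_eq_add_of_le hk
    obtain ⟨s, rfl⟩ := Nat.exists_eq_add_of_le (show u ≤ l by omega)
    obtain ⟨v, rfl⟩ := Nat.exists_eq_add_of_le' (show s ≤ k by omega)
    rw [show v + s + u - (v + s) = u by omega, show v + s + u - (u + s) = v by omega,
      qPoch_add q _ v s, qPoch_add q _ u s]
    have hbase : z * q ^ (-((v + s : ℕ) : ℤ)) * q ^ v = z * q ^ (-((u + s : ℕ) : ℤ)) * q ^ u := by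
      rw [mul_assoc, mul_assoc, ← zpow_natCast q v, ← zpow_natCast q u, ← zpow_add₀ hq,
        ← zpow_add₀ hq]
      congr 2
      push_cast
      ring
    rw [hbase]
    ring

lemma prod_erase_one_sub_zpow {q : ℂ} (hq : q ≠ 0) {n k : ℕ} (hk : k ≤ n) :
    ∏ j ∈ (range (n + 1)).erase k, (1 - q ^ j * (q ^ k)⁻¹)
      = qPoch q (q ^ (-(k : ℤ))) k * qPoch q q (n - k) := by
  obtain ⟨r, rfl⟩ := Nat.exists_eq_add_of_le hk
  have hset : (range (k + r + 1)).erase k = range k ∪ (range r).image (fun j => k + 1 + j) := by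
    ext j
    simp only [mem_erase, mem_range, mem_union, mem_image]
    constructor
    · rintro ⟨h1, h2⟩
      rcases lt_or_gt_of_ne h1 with h | h
      · exact Or.inl h
      · exact Or.inr ⟨j - (k + 1), by omega, by omega⟩
    · rintro (h | ⟨i, h, rfl⟩) <;> omega
  rw [hset, prod_union, prod_image (by simp), Nat.add_sub_cancel_left, qPoch, qPoch]
  · congr 1 <;> refine prod_congr rfl fun j _ => ?_
    · rw [zpow_neg, zpow_natCast, mul_comm]
    · field_simp
      ring
  · rw [disjoint_left]
    simp only [mem_range, mem_image]
    rintro j hj ⟨i, -, rfl⟩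
    omega

lemma qPoch_self_ne_zero {q : ℂ} {n : ℕ} (hq1 : ∀ j : ℕ, 1 ≤ j → j ≤ n → q ^ j ≠ 1) {k : ℕ}
    (hk : k ≤ n) : qPoch q q k ≠ 0 := by
  refine prod_ne_zero_iff.2 fun j hj => ?_
  rw [← pow_succ', sub_ne_zero]
  exact (hq1 (j + 1) (by omega) (by have := mem_range.1 hj; omega)).symm

lemma qBinom_mul_prod_erase {q : ℂ} (hq : q ≠ 0) {n k : ℕ} (hk : k ≤ n)
    (hq1 : ∀ j : ℕ, 1 ≤ j → j ≤ n → q ^ j ≠ 1) :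
    (-1) ^ k * q ^ (k * (k + 1) / 2) * qBinom q n k
      * ∏ j ∈ (range (n + 1)).erase k, (1 - q ^ j * (q ^ k)⁻¹) = qPoch q q n := by
  have h := qPoch_mul_zpow_neg hq one_ne_zero k
  rw [one_mul, div_one, one_pow, mul_one] at h
  rw [prod_erase_one_sub_zpow hq hk, qBinom]
  have h1 := qPoch_self_ne_zero hq1 hk
  have h2 := qPoch_self_ne_zero hq1 (Nat.sub_le n k)
  rw [← mul_div_assoc, div_mul_eq_mul_div, div_eq_iff (mul_ne_zero h1 h2)]
  linear_combination qPoch q q n * qPoch q q (n - k) * h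

lemma qBinom_mul_qPoch_mul_qPoch {q z : ℂ} (hq : q ≠ 0) (hz : z ≠ 0) {n k l : ℕ} (hk : k ≤ n)
    (hl : l ≤ n) :
    qBinom q n k * qPoch q (q / z) k * qPoch q (z * q ^ (-(l : ℤ))) (n - k) * z ^ k
      = (-1) ^ k * q ^ (k * (k + 1) / 2) * qBinom q n k
          * qPoch q (z * q ^ (-(l : ℤ))) l * qPoch q (z * q ^ (-(k : ℤ))) (n - l) := by
  linear_combination
    -qBinom q n k * qPoch q (z * q ^ (-(l : ℤ))) (n - k) * qPoch_mul_zpow_neg hq hz k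
      + (-1) ^ k * q ^ (k * (k + 1) / 2) * qBinom q n k * qPoch_mul_qPoch_swap hq z hk hl

theorem stmt_0 (q z : ℂ) (hq : q ≠ 0) (hz : z ≠ 0) (n l m : ℕ)
    (hl : l ≤ n) (hm : m ≤ n)
    (hq1 : ∀ j : ℕ, 1 ≤ j → j ≤ n → q ^ j ≠ 1)
    (hz1 : ∀ k : ℕ, k < n → z * q ^ ((k : ℤ) - (m : ℤ)) ≠ 1) :
    ∑ k ∈ (Finset.range (n + 1)).erase m,
        qBinom q n k * qPoch q (q / z) k * qPoch q (z * q ^ (-(l : ℤ))) (n - k) * z ^ k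
          / (1 - q ^ ((k : ℤ) - (m : ℤ)))
      = (-1) ^ m * q ^ (m * (m + 1) / 2) * qBinom q n m
          * qPoch q (z * q ^ (-(l : ℤ))) l * qPoch q (z * q ^ (-(m : ℤ))) (n - l)
          * ((∑ k ∈ Finset.range (n - l),
                z * q ^ ((k : ℤ) - (m : ℤ)) / (1 - z * q ^ ((k : ℤ) - (m : ℤ))))
             - ∑ k ∈ (Finset.range (n + 1)).erase m,
                q ^ ((k : ℤ) - (m : ℤ)) / (1 - q ^ ((k : ℤ) - (m : ℤ)))) := by
  have hpow (k : ℕ) : q ^ ((k : ℤ) - (m : ℤ)) = q ^ k * (q ^ m)⁻¹ := by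
    rw [zpow_sub₀ hq, zpow_natCast, zpow_natCast, div_eq_mul_inv]
  have hinj : Set.InjOn (fun k : ℕ => q ^ k) (range (n + 1)) := by
    have aux : ∀ i j : ℕ, i < j → j ≤ n → q ^ i ≠ q ^ j := by
      intro i j hij hj h
      refine hq1 (j - i) (by omega) (by omega) (mul_left_cancel₀ (pow_ne_zero i hq) ?_)
      rw [← pow_add, Nat.add_sub_cancel' hij.le, mul_one, h]
    intro i hi j hj h
    rw [mem_coe, mem_range] at hi hj
    by_contra hij
    rcases lt_or_gt_of_ne hij with h' | h'
    · exact aux i j h' (by omega) h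
    · exact aux j i h' (by omega) h.symm
  have main := sum_erase_div_one_sub (range (n + 1)) (range (n - l)) (fun k => q ^ k)
    (fun k => qBinom q n k * qPoch q (q / z) k * qPoch q (z * q ^ (-(l : ℤ))) (n - k) * z ^ k)
    (fun k => z * q ^ k) (qPoch q q n * qPoch q (z * q ^ (-(l : ℤ))) l)
    (fun j _ => pow_ne_zero j hq) hinj (by simp)
    (fun k hk => by
      have hk : k ≤ n := Nat.lt_succ_iff.1 (mem_range.1 hk)
      have hprod : ∏ j ∈ range (n - l), (1 - z * q ^ j * (q ^ k)⁻¹)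
          = qPoch q (z * q ^ (-(k : ℤ))) (n - l) := by
        refine prod_congr rfl fun j _ => ?_
        rw [zpow_neg, zpow_natCast]
        ring
      rw [hprod, qBinom_mul_qPoch_mul_qPoch hq hz hk hl, ← qBinom_mul_prod_erase hq hk hq1]
      ring)
    (m := m) (mem_range.2 (by omega))
    (fun j hj => by
      rw [mul_assoc, ← hpow, sub_ne_zero]
      exact (hz1 j (by have := mem_range.1 hj; omega)).symm)
  simp only [hpow, ← mul_assoc] at main ⊢
  rw [main, qBinom_mul_qPoch_mul_qPoch hq hz hm hl]
end

section
/- Let q, z, v be complex numbers with q ≠ 0, z ≠ 0, and let m, n ≥ 0 be integers. Assume q^j ≠ 1 for all 1 ≤ j ≤ m+n, z·q^{k-1} ≠ 1 for all 1 ≤ k ≤ max(m,n), and v·q^j ≠ 1 for all 0 ≤ j ≤ max(m,n)-1. Then ∑_{k=1}^{n} (q/z;q)_k · (v·q^m;q)_k · (z;q)_{n-k} · (z;q)_m · z^k / ( (q;q)_k · (v;q)_k · (q;q)_{n-k} · (q^k;q)_{m+1} ) − ∑_{k=1}^{m} (q/z;q)_k · (v·q^n;q)_k · (z;q)_{m-k}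 · (z;q)_n · z^k / ( (q;q)_k · (v;q)_k · (q;q)_{m-k} · (q^k;q)_{n+1} ) = (1 - z·q^{-1}) · (z;q)_m · (z;q)_n / ((q;q)_m · (q;q)_n) · ( ∑_{k=1}^{m} q^k/((1-z·q^{k-1})(1-q^k)) − ∑_{k=1}^{n} q^k/((1-z·q^{k-1})(1-q^k)) ). -/
open Finset

lemma qPoch_succ (q x : ℂ) (N : ℕ) : qPoch q x (N + 1) = qPoch q x N * (1 - x * q ^ N) :=
  Finset.prod_range_succ _ _

lemma qPoch_ne_zero {q x : ℂ} {N : ℕ} (h : ∀ j < N, x * q ^ j ≠ 1) : qPoch q x N ≠ 0 :=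
  Finset.prod_ne_zero_iff.2 fun j hj =>
    sub_ne_zero.2 (h j (Finset.mem_range.1 hj)).symm

lemma qPoch_self_ne_zero_s2 {q : ℂ} {N : ℕ} (h : ∀ j, 1 ≤ j → j ≤ N → q ^ j ≠ 1) :
    qPoch q q N ≠ 0 :=
  qPoch_ne_zero fun j hj => by
    rw [← pow_succ']
    exact h (j + 1) (by omega) (by omega)

/-- The summand, normalised by `(z;q)_m (z;q)_n / ((q;q)_m (q;q)_n)`. -/
noncomputable def normTerm (q z v : ℂ) (m n k : ℕ) : ℂ :=
  qPoch q (q / z) k * qPoch q (v * q ^ m) k * qPoch q z (n - k) * z ^ k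
      * (qPoch q q m * qPoch q q n)
    / (qPoch q q k * qPoch q v k * qPoch q q (n - k) * qPoch q (q ^ k) (m + 1) * qPoch q z n)

/-- The sum of the normalised summands over `1 ≤ k ≤ n`. -/
noncomputable def normSum (q z v : ℂ) (m n : ℕ) : ℂ :=
  ∑ i ∈ Finset.range n, normTerm q z v m n (i + 1)

/-- The partial sums on the right-hand side. -/
noncomputable def harmSum (q z : ℂ) (n : ℕ) : ℂ :=
  ∑ i ∈ Finset.range n, q ^ (i + 1) / ((1 - z * q ^ i) * (1 - q ^ (i + 1)))

lemma normTerm_succ_left (q z v : ℂ) (m n k : ℕ) (h : 1 - v * q ^ m ≠ 0) :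
    normTerm q z v (m + 1) n k = normTerm q z v m n k *
      ((1 - v * q ^ m * q ^ k) * (1 - q * q ^ m)
        / ((1 - v * q ^ m) * (1 - q * q ^ m * q ^ k))) := by
  have hV : qPoch q (v * q ^ (m + 1)) k
      = qPoch q (v * q ^ m) k * (1 - v * q ^ m * q ^ k) / (1 - v * q ^ m) := by
    rw [eq_div_iff h, ← qPoch_succ, qPoch_succ_left, pow_succ, ← mul_assoc, mul_comm]
  unfold normTerm
  rw [hV, qPoch_succ q q m, qPoch_succ q (q ^ k) (m + 1),
    show q ^ k * q ^ (m + 1) = q * q ^ m * q ^ k by ring]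
  simp only [div_eq_mul_inv, mul_inv]
  ring

lemma normTerm_succ_right (q z v : ℂ) (m k l : ℕ) :
    normTerm q z v m (k + l + 1) k = normTerm q z v m (k + l) k *
      ((1 - z * q ^ l) * (1 - q * (q ^ k * q ^ l))
        / ((1 - q * q ^ l) * (1 - z * (q ^ k * q ^ l)))) := by
  unfold normTerm
  rw [show k + l + 1 - k = l + 1 by omega, show k + l - k = l by omega]
  simp only [qPoch_succ, ← pow_add]
  simp only [div_eq_mul_inv, mul_inv]
  ring

lemma normTerm_succ_succ (q z v : ℂ) (m k l : ℕ) (hz : z ≠ 0) (hk : 1 - q ^ k ≠ 0) :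
    normTerm q z v m (k + l + 1) (k + 1) = normTerm q z v m (k + l) k *
      ((z - q * q ^ k) * (1 - v * q ^ m * q ^ k) * (1 - q * (q ^ k * q ^ l)) * (1 - q ^ k)
        / ((1 - q * q ^ k) * (1 - v * q ^ k) * (1 - z * (q ^ k * q ^ l))
          * (1 - q * q ^ m * q ^ k))) := by
  have hX : (qPoch q (q ^ (k + 1)) (m + 1))⁻¹
      = (qPoch q (q ^ k) (m + 1))⁻¹ * ((1 - q ^ k) * (1 - q * q ^ m * q ^ k)⁻¹) := by
    have h1 : (1 - q ^ k) * qPoch q (q ^ (k + 1)) (m + 1)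
        = qPoch q (q ^ k) (m + 1) * (1 - q * q ^ m * q ^ k) := by
      rw [pow_succ q k, ← qPoch_succ_left, qPoch_succ q (q ^ k) (m + 1)]
      ring
    have h2 := congrArg Inv.inv h1
    rw [mul_inv, mul_inv] at h2
    calc _ = (1 - q ^ k) * ((1 - q ^ k)⁻¹ * (qPoch q (q ^ (k + 1)) (m + 1))⁻¹) := by
          rw [mul_inv_cancel_left₀ hk]
      _ = _ := by rw [h2]; ring
  have hY : qPoch q (q / z) (k + 1) * z ^ (k + 1)
      = qPoch q (q / z) k * z ^ k * (z - q * q ^ k) := by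
    rw [qPoch_succ]
    field_simp
    ring
  unfold normTerm
  rw [show k + l + 1 - (k + 1) = l by omega, show k + l - k = l by omega]
  rw [show qPoch q (q / z) (k + 1) * qPoch q (v * q ^ m) (k + 1) * qPoch q z l * z ^ (k + 1)
    = (qPoch q (q / z) (k + 1) * z ^ (k + 1)) * qPoch q (v * q ^ m) (k + 1) * qPoch q z l
      by ring, hY]
  simp only [div_eq_mul_inv, mul_inv, hX]
  simp only [qPoch_succ, ← pow_add]
  simp only [mul_inv]
  ring

/-- Nonvanishing conditions attached to the pair `(m, n)`. -/
def Admissible (q z v : ℂ) (m n : ℕ) : Prop :=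
  (∀ j : ℕ, 1 ≤ j → j ≤ m + n → 1 - q ^ j ≠ 0) ∧
    (∀ j : ℕ, j < max m n → 1 - z * q ^ j ≠ 0) ∧ ∀ j : ℕ, j < max m n → 1 - v * q ^ j ≠ 0

lemma Admissible.mono {q z v : ℂ} {m n m' n' : ℕ} (h : Admissible q z v m n) (hm : m' ≤ m)
    (hn : n' ≤ n) : Admissible q z v m' n' :=
  ⟨fun j h1 h2 => h.1 j h1 (by omega), fun j hj => h.2.1 j (by omega),
    fun j hj => h.2.2 j (by omega)⟩

lemma Admissible.symm {q z v : ℂ} {m n : ℕ} (h : Admissible q z v m n) :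
    Admissible q z v n m :=
  ⟨fun j h1 h2 => h.1 j h1 (by omega), fun j hj => h.2.1 j (by omega),
    fun j hj => h.2.2 j (by omega)⟩

/-- Coefficient in the lattice recurrences of `normSum`. -/
noncomputable def recCoeff (q w : ℂ) (m n : ℕ) : ℂ :=
  (1 - w * q * q ^ m * q ^ n) * (1 - q * q ^ n)
    / ((1 - w * q ^ n) * (1 - q ^ 2 * q ^ m * q ^ n))

lemma normSum_recurrence (q z v : ℂ) (m n : ℕ) (h : Admissible q z v (m + 1) (n + 1)) :
    normSum q z v (m + 1) (n + 1) - normSum q z v m n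
      = recCoeff q z m n * (normSum q z v (m + 1) n - normSum q z v m n)
        + recCoeff q v n m * (normSum q z v m (n + 1) - normSum q z v m n) := by
  obtain ⟨h1, h2, h3⟩ := h
  have hv := h3 m (by omega)
  have hzn := h2 n (by omega)
  have hmn : 1 - q ^ 2 * q ^ m * q ^ n ≠ 0 := by
    have := h1 (m + n + 2) (by omega) (by omega)
    convert this using 2; ring
  have key : ∀ i ∈ Finset.range n,
      normTerm q z v (m + 1) (n + 1) (i + 1) - normTerm q z v m n (i + 1)
      = recCoeff q z m n * (normTerm q z v (m + 1) n (i + 1) - normTerm q z v m n (i + 1))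
        + recCoeff q v n m *
          (normTerm q z v m (n + 1) (i + 1) - normTerm q z v m n (i + 1)) := by
    intro i hi
    obtain ⟨l, rfl⟩ : ∃ l, n = i + 1 + l :=
      ⟨n - (i + 1), by have := Finset.mem_range.1 hi; omega⟩
    have e1 := h1 (l + 1) (by omega) (by omega)
    have e2 := h1 (m + 1 + (i + 1)) (by omega) (by omega)
    rw [pow_succ'] at e1
    rw [pow_add, pow_succ'] at e2
    unfold recCoeff
    rw [normTerm_succ_left _ _ _ _ _ _ hv, normTerm_succ_left _ _ _ _ _ _ hv,
      normTerm_succ_right]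
    rw [pow_add q (i + 1) l] at hzn hmn ⊢
    generalize q ^ (i + 1) = K at *
    generalize q ^ l = L at *
    generalize q ^ m = Q at *
    have hmn' : 1 - q ^ 2 * (K * L) * Q ≠ 0 := by convert hmn using 2; ring
    generalize hd0 : 1 - q * L = d0 at e1 ⊢
    generalize hd1 : 1 - z * (K * L) = d1 at hzn ⊢
    generalize hd2 : 1 - v * Q = d2 at hv ⊢
    generalize hd3 : 1 - q * Q * K = d3 at e2 ⊢
    generalize hd4 : 1 - q ^ 2 * Q * (K * L) = d4 at hmn ⊢
    generalize hd5 : 1 - q ^ 2 * (K * L) * Q = d5 at hmn' ⊢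
    field_simp
    subst hd0 hd1 hd2 hd3 hd4 hd5
    ring
  have top : normTerm q z v (m + 1) (n + 1) (n + 1)
      = recCoeff q v n m * normTerm q z v m (n + 1) (n + 1) := by
    rw [normTerm_succ_left _ _ _ _ _ _ hv, recCoeff, mul_comm]
    congr 2 <;> ring
  have hs := Finset.sum_congr rfl key
  simp only [Finset.sum_add_distrib, Finset.sum_sub_distrib, ← Finset.mul_sum] at hs
  simp only [normSum, Finset.sum_range_succ _ n, top]
  linear_combination hs

lemma normSum_recurrence_swap (q z v : ℂ) (hq : q ≠ 0) (hz : z ≠ 0) (m n : ℕ)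
    (h : Admissible q z v (m + 1) (n + 1)) :
    normSum q z v (m + 1) (n + 1) - normSum q z v m n
      = recCoeff q v m n * (normSum q z v (m + 1) n - normSum q z v m n)
        + recCoeff q z n m * (normSum q z v m (n + 1) - normSum q z v m n)
        + (q - z) * q ^ m * q ^ n * (z - v) * (1 - q * q ^ n)
          / ((1 - q ^ 2 * q ^ m * q ^ n) * (1 - v * q ^ n) * (1 - z * q ^ m)
            * (1 - z * q ^ n)) := by
  obtain ⟨h1, h2, h3⟩ := h
  have hv := h3 m (by omega)
  have hvn := h3 n (by omega)
  have hzn := h2 n (by omega)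
  have hzm := h2 m (by omega)
  have hmn : 1 - q ^ 2 * q ^ m * q ^ n ≠ 0 := by
    have := h1 (m + n + 2) (by omega) (by omega)
    convert this using 2; ring
  set ρ : ℂ := q * q ^ m * q ^ n * (z - v) * (1 - q * q ^ m)
    / ((1 - q ^ 2 * q ^ m * q ^ n) * (1 - v * q ^ n) * (1 - z * q ^ m) * (1 - v * q ^ m))
    with hρ
  set G : ℕ → ℂ := fun i => ρ * ((1 - q ^ (i + 1)) * (1 - v * q ^ i) / q ^ (i + 1))
    * normTerm q z v m (n + 1) (i + 1) with hG
  have key : ∀ i ∈ Finset.range n,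
      normTerm q z v (m + 1) (n + 1) (i + 1) - normTerm q z v m n (i + 1)
      - recCoeff q v m n * (normTerm q z v (m + 1) n (i + 1) - normTerm q z v m n (i + 1))
        - recCoeff q z n m *
          (normTerm q z v m (n + 1) (i + 1) - normTerm q z v m n (i + 1))
      = G (i + 1) - G i := by
    intro i hi
    obtain ⟨l, rfl⟩ : ∃ l, n = i + 1 + l :=
      ⟨n - (i + 1), by have := Finset.mem_range.1 hi; omega⟩
    have e1 := h1 (l + 1) (by omega) (by omega)
    have e2 := h1 (m + 1 + (i + 1)) (by omega) (by omega)
    have e3 := h1 (i + 1) (by omega) (by omega)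
    have e4 := h1 (i + 1 + 1) (by omega) (by omega)
    have e5 := h3 (i + 1) (by omega)
    rw [pow_succ'] at e1
    rw [pow_add, pow_succ'] at e2
    rw [pow_succ'] at e4
    simp only [hG, hρ]
    unfold recCoeff
    rw [normTerm_succ_left _ _ _ _ _ _ hv, normTerm_succ_left _ _ _ _ _ _ hv,
      normTerm_succ_succ _ _ _ _ _ _ hz e3, normTerm_succ_right]
    rw [pow_add q (i + 1) l] at hzn hmn hvn ⊢
    rw [pow_succ' q (i + 1)]
    have hi : q ^ i = q ^ (i + 1) / q := by rw [pow_succ]; field_simp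
    have hK : q ^ (i + 1) ≠ 0 := pow_ne_zero _ hq
    rw [hi]
    generalize q ^ (i + 1) = K at *
    generalize q ^ l = L at *
    generalize q ^ m = Q at *
    generalize normTerm q z v m (i + 1 + l) (i + 1) = T
    have hmn' : 1 - q ^ 2 * (K * L) * Q ≠ 0 := by convert hmn using 2; ring
    generalize hd0 : 1 - q * L = d0 at e1 ⊢
    generalize hd1 : 1 - z * (K * L) = d1 at hzn ⊢
    generalize hd2 : 1 - v * Q = d2 at hv ⊢
    generalize hd3 : 1 - q * Q * K = d3 at e2 ⊢
    generalize hd4 : 1 - q ^ 2 * Q * (K * L) = d4 at hmn ⊢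
    generalize hd5 : 1 - q ^ 2 * (K * L) * Q = d5 at hmn' ⊢
    generalize hd6 : 1 - v * (K * L) = d6 at hvn ⊢
    generalize hd7 : 1 - z * Q = d7 at hzm ⊢
    generalize hd8 : 1 - q * K = d8 at e4 ⊢
    generalize hd9 : 1 - v * K = d9 at e5 ⊢
    field_simp
    subst hd0 hd1 hd2 hd3 hd4 hd5 hd6 hd7 hd8 hd9
    ring
  have top : normTerm q z v (m + 1) (n + 1) (n + 1)
      - recCoeff q z n m * normTerm q z v m (n + 1) (n + 1) = - G n := by
    simp only [hG, hρ]
    rw [normTerm_succ_left _ _ _ _ _ _ hv, recCoeff]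
    have hN : q ^ n ≠ 0 := pow_ne_zero _ hq
    rw [pow_succ' q n]
    generalize q ^ n = N at *
    generalize q ^ m = Q at *
    generalize normTerm q z v m (n + 1) (n + 1) = T
    have hmn' : 1 - q ^ 2 * N * Q ≠ 0 := by convert hmn using 2; ring
    have hmn2 : 1 - q * Q * (q * N) ≠ 0 := by convert hmn using 2; ring
    generalize hd0 : 1 - v * Q = d0 at hv ⊢
    generalize hd1 : 1 - z * Q = d1 at hzm ⊢
    generalize hd2 : 1 - v * N = d2 at hvn ⊢
    generalize hd3 : 1 - q ^ 2 * Q * N = d3 at hmn ⊢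
    generalize hd4 : 1 - q ^ 2 * N * Q = d4 at hmn' ⊢
    generalize hd5 : 1 - q * Q * (q * N) = d5 at hmn2 ⊢
    field_simp
    subst hd0 hd1 hd2 hd3 hd4 hd5
    ring
  have bot : G 0 = -((q - z) * q ^ m * q ^ n * (z - v) * (1 - q * q ^ n)
          / ((1 - q ^ 2 * q ^ m * q ^ n) * (1 - v * q ^ n) * (1 - z * q ^ m)
            * (1 - z * q ^ n))) := by
    have hm := h1 (m + 1) (by omega) (by omega)
    have hq1 := h1 1 (by omega) (by omega)
    have hv0 := h3 0 (by omega)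
    have hqm : qPoch q q m ≠ 0 := qPoch_self_ne_zero_s2 fun j hj hj' =>
      (sub_ne_zero.1 (h1 j hj (by omega))).symm
    have hqn : qPoch q q n ≠ 0 := qPoch_self_ne_zero_s2 fun j hj hj' =>
      (sub_ne_zero.1 (h1 j hj (by omega))).symm
    have hzn' : qPoch q z n ≠ 0 := qPoch_ne_zero fun j hj =>
      (sub_ne_zero.1 (h2 j (by omega))).symm
    simp only [hG, hρ, normTerm]
    rw [pow_succ'] at hm
    rw [show n + 1 - (0 + 1) = n by omega]
    simp only [zero_add, pow_one, pow_zero, mul_one] at hq1 hv0 ⊢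
    have one : ∀ x, qPoch q x 1 = 1 - x := fun x => by simp [qPoch]
    simp only [one, qPoch_succ]
    generalize q ^ n = N at *
    generalize q ^ m = Q at *
    generalize hd0 : 1 - v * Q = d0 at hv ⊢
    generalize hd1 : 1 - z * Q = d1 at hzm ⊢
    generalize hd2 : 1 - v * N = d2 at hvn ⊢
    generalize hd3 : 1 - z * N = d3 at hzn ⊢
    generalize hd4 : 1 - q * Q = d4 at hm ⊢
    generalize hd5 : 1 - q ^ 2 * Q * N = d5 at hmn ⊢
    field_simp
    subst hd0 hd1 hd2 hd3 hd4 hd5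
    ring
  have hs := Finset.sum_congr rfl key
  rw [Finset.sum_range_sub] at hs
  simp only [Finset.sum_sub_distrib, ← Finset.mul_sum] at hs
  simp only [normSum, Finset.sum_range_succ _ n]
  linear_combination hs + top - bot

lemma normSum_zero_left (q z v : ℂ) (hq : q ≠ 0) (hz : z ≠ 0) (n : ℕ)
    (h : Admissible q z v 0 n) :
    normSum q z v 0 n = -((1 - z * q⁻¹) * harmSum q z n) := by
  induction n with
  | zero => simp [normSum, harmSum]
  | succ n ih =>
    have ih := ih (h.mono le_rfl (by omega))
    obtain ⟨h1, h2, h3⟩ := h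
    have hzn := h2 n (by omega)
    have hn := h1 (n + 1) (by omega) (by omega)
    rw [pow_succ'] at hn
    set G : ℕ → ℂ := fun i => -(q * q ^ n / (1 - q * q ^ n) ^ 2)
      * ((1 - q ^ (i + 1)) ^ 2 / q ^ (i + 1)) * normTerm q z v 0 (n + 1) (i + 1) with hG
    have key : ∀ i ∈ Finset.range n,
        normTerm q z v 0 (n + 1) (i + 1) - normTerm q z v 0 n (i + 1) = G (i + 1) - G i := by
      intro i hi
      obtain ⟨l, rfl⟩ : ∃ l, n = i + 1 + l :=
        ⟨n - (i + 1), by have := Finset.mem_range.1 hi; omega⟩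
      have e1 := h1 (l + 1) (by omega) (by omega)
      have e3 := h1 (i + 1) (by omega) (by omega)
      have e4 := h1 (i + 1 + 1) (by omega) (by omega)
      have e5 := h3 (i + 1) (by omega)
      rw [pow_succ'] at e1 e4
      simp only [hG]
      rw [normTerm_succ_succ _ _ _ _ _ _ hz e3, normTerm_succ_right]
      rw [pow_add q (i + 1) l] at hzn hn ⊢
      rw [pow_succ' q (i + 1)]
      have hK : q ^ (i + 1) ≠ 0 := pow_ne_zero _ hq
      rw [pow_zero, mul_one, mul_one]
      generalize q ^ (i + 1) = K at *
      generalize q ^ l = L at *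
      generalize normTerm q z v 0 (i + 1 + l) (i + 1) = T
      generalize hd0 : 1 - q * L = d0 at e1 ⊢
      generalize hd1 : 1 - z * (K * L) = d1 at hzn ⊢
      generalize hd2 : 1 - q * (K * L) = d2 at hn ⊢
      generalize hd3 : 1 - q * K = d3 at e4 ⊢
      generalize hd4 : 1 - v * K = d4 at e5 ⊢
      field_simp
      subst hd0 hd1 hd2 hd3 hd4
      ring
    have top : normTerm q z v 0 (n + 1) (n + 1) = -G n := by
      simp only [hG]
      have hN : q ^ n ≠ 0 := pow_ne_zero _ hq
      rw [pow_succ' q n]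
      field_simp
    have bot : G 0 = (1 - z * q⁻¹) * (q ^ (n + 1) / ((1 - z * q ^ n) * (1 - q ^ (n + 1)))) := by
      have hq1 := h1 1 (by omega) (by omega)
      have hv0 := h3 0 (by omega)
      have hqn : qPoch q q n ≠ 0 := qPoch_self_ne_zero_s2 fun j hj hj' =>
        (sub_ne_zero.1 (h1 j hj (by omega))).symm
      have hzn' : qPoch q z n ≠ 0 := qPoch_ne_zero fun j hj =>
        (sub_ne_zero.1 (h2 j (by omega))).symm
      simp only [hG, normTerm]
      rw [show n + 1 - (0 + 1) = n by omega, pow_succ' q n]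
      simp only [zero_add, pow_one, pow_zero, mul_one] at hq1 hv0 ⊢
      have one : ∀ x, qPoch q x 1 = 1 - x := fun x => by simp [qPoch]
      have zero : ∀ x, qPoch q x 0 = 1 := fun x => by simp [qPoch]
      simp only [one, zero, qPoch_succ]
      field_simp
      ring
    have hs := Finset.sum_congr rfl key
    rw [Finset.sum_range_sub, Finset.sum_sub_distrib] at hs
    simp only [normSum, harmSum, Finset.sum_range_succ _ n] at ih ⊢
    linear_combination hs + top - bot + ih

lemma normSum_sub_swap (q z v : ℂ) (hq : q ≠ 0) (hz : z ≠ 0) (m n : ℕ)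
    (h : Admissible q z v m n) :
    normSum q z v m n - normSum q z v n m
      = (1 - z * q⁻¹) * (harmSum q z m - harmSum q z n) := by
  induction m generalizing n with
  | zero =>
    rw [normSum_zero_left q z v hq hz n h]
    simp [normSum, harmSum]
  | succ m ihm =>
    induction n with
    | zero =>
      rw [normSum_zero_left q z v hq hz _ h.symm]
      simp [normSum, harmSum]
    | succ n ihn =>
      have d1 := ihn (h.mono le_rfl (by omega))
      have d2 := ihm (n + 1) (h.mono (by omega) le_rfl)
      have d3 := ihm n (h.mono (by omega) (by omega))
      have r1 := normSum_recurrence_swap q z v hq hz m n h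
      have r2 := normSum_recurrence q z v n m h.symm
      obtain ⟨h1, h2, h3⟩ := h
      have hvn := h3 n (by omega)
      have hzn := h2 n (by omega)
      have hzm := h2 m (by omega)
      have hm := h1 (m + 1) (by omega) (by omega)
      have hn := h1 (n + 1) (by omega) (by omega)
      have hmn : 1 - q ^ 2 * q ^ m * q ^ n ≠ 0 := by
        have := h1 (m + n + 2) (by omega) (by omega)
        convert this using 2; ring
      have hS : (q - z) * q ^ m * q ^ n * (z - v) * (1 - q * q ^ n)
          / ((1 - q ^ 2 * q ^ m * q ^ n) * (1 - v * q ^ n) * (1 - z * q ^ m)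
            * (1 - z * q ^ n))
          = (1 - z * q⁻¹) * ((1 - recCoeff q v m n)
              * (q ^ (m + 1) / ((1 - z * q ^ m) * (1 - q ^ (m + 1))))
            - (1 - recCoeff q z n m)
              * (q ^ (n + 1) / ((1 - z * q ^ n) * (1 - q ^ (n + 1))))) := by
        unfold recCoeff
        rw [pow_succ'] at hm hn
        rw [pow_succ' q m, pow_succ' q n]
        generalize q ^ n = N at *
        generalize q ^ m = Q at *
        have hmn' : 1 - q ^ 2 * N * Q ≠ 0 := by convert hmn using 2; ring
        generalize hd0 : 1 - v * N = d0 at hvn ⊢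
        generalize hd1 : 1 - z * N = d1 at hzn ⊢
        generalize hd2 : 1 - z * Q = d2 at hzm ⊢
        generalize hd3 : 1 - q * Q = d3 at hm ⊢
        generalize hd4 : 1 - q * N = d4 at hn ⊢
        generalize hd5 : 1 - q ^ 2 * Q * N = d5 at hmn ⊢
        generalize hd6 : 1 - q ^ 2 * N * Q = d6 at hmn' ⊢
        field_simp
        subst hd0 hd1 hd2 hd3 hd4 hd5 hd6
        ring
      have s : ∀ k, harmSum q z (k + 1)
          = harmSum q z k + q ^ (k + 1) / ((1 - z * q ^ k) * (1 - q ^ (k + 1))) :=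
        fun k => Finset.sum_range_succ _ _
      rw [s] at d1 d2 ⊢
      rw [s]
      linear_combination r1 - r2 + hS + recCoeff q v m n * (d1 - d3)
        + recCoeff q z n m * (d2 - d3) + d3

lemma sum_eq_mul_normSum (q z v : ℂ) (m n : ℕ) (h : Admissible q z v m n) :
    ∑ k ∈ Finset.Icc 1 n,
        qPoch q (q / z) k * qPoch q (v * q ^ m) k * qPoch q z (n - k) * qPoch q z m * z ^ k
          / (qPoch q q k * qPoch q v k * qPoch q q (n - k) * qPoch q (q ^ k) (m + 1))
      = qPoch q z m * qPoch q z n / (qPoch q q m * qPoch q q n) * normSum q z v m n := by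
  obtain ⟨h1, h2, -⟩ := h
  have hqm : qPoch q q m ≠ 0 := qPoch_self_ne_zero_s2 fun j hj hj' =>
    (sub_ne_zero.1 (h1 j hj (by omega))).symm
  have hqn : qPoch q q n ≠ 0 := qPoch_self_ne_zero_s2 fun j hj hj' =>
    (sub_ne_zero.1 (h1 j hj (by omega))).symm
  have hzn : qPoch q z n ≠ 0 := qPoch_ne_zero fun j hj =>
    (sub_ne_zero.1 (h2 j (by omega))).symm
  rw [normSum, Finset.mul_sum, Finset.sum_bij' (fun k _ => k - 1) (fun i _ => i + 1)]
  · intro k hk; simp only [Finset.mem_Icc, Finset.mem_range] at *; omega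
  · intro k hk; simp only [Finset.mem_Icc, Finset.mem_range] at *; omega
  · intro k hk; simp only [Finset.mem_Icc] at *; omega
  · intro k hk; simp
  · intro k hk
    rw [Nat.sub_add_cancel (Finset.mem_Icc.1 hk).1, normTerm]
    generalize qPoch q q k * qPoch q v k * qPoch q q (n - k) * qPoch q (q ^ k) (m + 1) = d
    by_cases hd : d = 0
    · simp [hd]
    · field_simp

lemma sum_eq_harmSum (q z : ℂ) (n : ℕ) :
    ∑ k ∈ Finset.Icc 1 n, q ^ k / ((1 - z * q ^ (k - 1)) * (1 - q ^ k)) = harmSum q z n := by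
  induction n with
  | zero => simp [harmSum]
  | succ n ih =>
    rw [Finset.sum_Icc_succ_top (by omega), ih, harmSum, harmSum, Finset.sum_range_succ]
    simp

theorem stmt_2 (q z v : ℂ) (hq : q ≠ 0) (hz : z ≠ 0) (m n : ℕ)
    (hq1 : ∀ j : ℕ, 1 ≤ j → j ≤ m + n → q ^ j ≠ 1)
    (hz1 : ∀ k : ℕ, 1 ≤ k → k ≤ max m n → z * q ^ (k - 1) ≠ 1)
    (hv : ∀ j : ℕ, j < max m n → v * q ^ j ≠ 1) :
    (∑ k ∈ Finset.Icc 1 n,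
        qPoch q (q / z) k * qPoch q (v * q ^ m) k * qPoch q z (n - k) * qPoch q z m * z ^ k
          / (qPoch q q k * qPoch q v k * qPoch q q (n - k) * qPoch q (q ^ k) (m + 1)))
      - (∑ k ∈ Finset.Icc 1 m,
          qPoch q (q / z) k * qPoch q (v * q ^ n) k * qPoch q z (m - k) * qPoch q z n * z ^ k
            / (qPoch q q k * qPoch q v k * qPoch q q (m - k) * qPoch q (q ^ k) (n + 1)))
      = (1 - z * q⁻¹) * qPoch q z m * qPoch q z n / (qPoch q q m * qPoch q q n)
          * ((∑ k ∈ Finset.Icc 1 m, q ^ k / ((1 - z * q ^ (k - 1)) * (1 - q ^ k)))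
             - ∑ k ∈ Finset.Icc 1 n, q ^ k / ((1 - z * q ^ (k - 1)) * (1 - q ^ k))) := by
  have h : Admissible q z v m n := by
    refine ⟨fun j h1 h2 => sub_ne_zero.2 (hq1 j h1 h2).symm, fun j hj => ?_,
      fun j hj => sub_ne_zero.2 (hv j hj).symm⟩
    simpa using sub_ne_zero.2 (hz1 (j + 1) (by omega) (by omega)).symm
  rw [sum_eq_mul_normSum q z v m n h, sum_eq_mul_normSum q z v n m h.symm, sum_eq_harmSum,
    sum_eq_harmSum]
  linear_combination qPoch q z m * qPoch q z n / (qPoch q q m * qPoch q q n)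
    * normSum_sub_swap q z v hq hz m n h
end

section
/- Let m, n ≥ 1 be integers and let x be a real number such that x + t ≠ 0 for every integer t with −m ≤ t ≤ n−1. Then ∑_{k=1}^{n} C(n,k) · (m−x)_k · (x)_{n−k} / ( (x−m)_{m+n} · k^m ) = − ∑_{1 ≤ k_m ≤ k_{m-1} ≤ ⋯ ≤ k_1 ≤ n} 1 / ( k_1·k_2⋯k_m · (x+k_1−1)·(x+k_2−2)⋯(x+k_m−m) ). -/
open Finset

/-- The rising factorial `(x)_N = x (x+1) ⋯ (x+N-1)`. -/
noncomputable def risingFac (x : ℝ) (N : ℕ) : ℝ := ∏ j ∈ Finset.range N, (x + j)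

/-- `nestedSumR f i r N = ∑_{1 ≤ k_r ≤ ⋯ ≤ k_1 ≤ N} ∏_{s=1}^{r} f (i+s-1) k_s`:
the `r`-fold nested sum `∑_{k_1=1}^{N} f i k_1 ∑_{k_2=1}^{k_1} f (i+1) k_2 ⋯`. -/
noncomputable def nestedSumR (f : ℕ → ℕ → ℝ) : ℕ → ℕ → ℕ → ℝ
  | _, 0, _ => 1
  | i, r + 1, N => ∑ k ∈ Finset.Icc 1 N, f i k * nestedSumR f (i + 1) r k

lemma risingFac_succ (x : ℝ) (N : ℕ) : risingFac x (N + 1) = risingFac x N * (x + N) :=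
  Finset.prod_range_succ _ _

lemma risingFac_succ_left (x : ℝ) (N : ℕ) : risingFac x (N + 1) = x * risingFac (x + 1) N := by
  simp only [risingFac, Finset.prod_range_succ', Nat.cast_zero, add_zero, mul_comm x]
  congr 1
  refine Finset.prod_congr rfl fun j _ => ?_
  push_cast
  ring

lemma risingFac_ne_zero {x : ℝ} {N : ℕ} (h : ∀ j < N, x + j ≠ 0) : risingFac x N ≠ 0 :=
  Finset.prod_ne_zero_iff.2 fun j hj => h j (Finset.mem_range.1 hj)

/-- The Chu–Vandermonde identity for rising factorials. -/
lemma sum_choose_mul_risingFac (a b : ℝ) (n : ℕ) :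
    ∑ p ∈ Finset.HasAntidiagonal.antidiagonal n, (n.choose p.1 : ℝ) * (risingFac a p.1 * risingFac b p.2)
      = risingFac (a + b) n := by
  induction n with
  | zero => simp [risingFac]
  | succ n ih =>
    rw [Finset.sum_antidiagonal_choose_succ_mul (fun i j => risingFac a i * risingFac b j),
      risingFac_succ, ← ih, Finset.sum_mul, ← Finset.sum_add_distrib]
    refine Finset.sum_congr rfl fun p hp => ?_
    obtain ⟨i, j⟩ := p
    obtain rfl : i + j = n := Finset.HasAntidiagonal.mem_antidiagonal.1 hp
    simp only [risingFac_succ]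
    rw [Nat.choose_symm_add (a := i) (b := j)]
    push_cast
    ring

lemma nestedSumR_shift {f g : ℕ → ℕ → ℝ} (h : ∀ i k, f (i + 1) k = g i k) (i r N : ℕ) :
    nestedSumR f (i + 1) r N = nestedSumR g i r N := by
  induction r generalizing i N with
  | zero => rfl
  | succ r ih => simp only [nestedSumR, h, ih]

/-- The binomial sum on the left-hand side of the identity. -/
noncomputable def binomialRisingSum (m n : ℕ) (x : ℝ) : ℝ :=
  ∑ k ∈ Finset.Icc 1 n, (n.choose k : ℝ) * risingFac ((m : ℝ) - x) k * risingFac x (n - k)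
    / (risingFac (x - m) (m + n) * (k : ℝ) ^ m)

lemma binomialRisingSum_zero_left {n : ℕ} (hn : 1 ≤ n) {x : ℝ} (hx : risingFac x n ≠ 0) :
    binomialRisingSum 0 n x = -1 := by
  have h := sum_choose_mul_risingFac (-x) x n
  obtain ⟨n, rfl⟩ := Nat.exists_eq_add_of_le' hn
  rw [neg_add_cancel, risingFac_succ_left, zero_mul,
    Finset.Nat.sum_antidiagonal_eq_sum_range_succ_mk, Finset.range_eq_Ico,
    Finset.sum_eq_sum_Ico_succ_bot (Nat.succ_pos _), Nat.succ_eq_add_one,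
    Finset.Ico_add_one_right_eq_Icc] at h
  simp only [Nat.choose_zero_right, risingFac, Finset.prod_range_zero, Nat.cast_one, one_mul,
    Nat.sub_zero] at h hx
  simp only [binomialRisingSum, ← Finset.sum_div, risingFac, Nat.cast_zero, sub_zero, zero_sub,
    pow_zero, mul_one, zero_add, mul_assoc] at h ⊢
  rw [div_eq_iff hx]
  linear_combination h

lemma choose_mul_risingFac_succ (n k : ℕ) (hk : k ≤ n + 1) (x : ℝ) :
    (n + 1 : ℝ) * ((n + 1).choose k * risingFac x (n + 1 - k))
      = (n + 1) * (n.choose k * risingFac x (n - k) * (x + n))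
        + (n + 1).choose k * risingFac (x - 1) (n + 1 - k) * k := by
  obtain rfl | hk := hk.eq_or_lt
  · simp [risingFac]
  · obtain ⟨j, rfl⟩ := Nat.exists_eq_add_of_le (Nat.lt_succ_iff.1 hk)
    have hc := Nat.choose_mul_succ_eq (k + j) k
    rw [show k + j + 1 - k = j + 1 by omega] at hc ⊢
    rw [Nat.add_sub_cancel_left, risingFac_succ, risingFac_succ_left (x - 1), sub_add_cancel]
    replace hc := congrArg (Nat.cast (R := ℝ)) hc
    push_cast at hc ⊢
    linear_combination (-(risingFac x j) * (x + k + j)) * hc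

lemma binomialRisingSum_succ (m n : ℕ) {x : ℝ} (hx : x + n ≠ 0) :
    binomialRisingSum (m + 1) (n + 1) x = binomialRisingSum (m + 1) n x
      + binomialRisingSum m (n + 1) (x - 1) / ((n + 1) * (x + n)) := by
  have hext : binomialRisingSum (m + 1) n x = ∑ k ∈ Finset.Icc 1 (n + 1), (n.choose k : ℝ) *
      risingFac (((m + 1 : ℕ) : ℝ) - x) k * risingFac x (n - k)
        / (risingFac (x - (m + 1 : ℕ)) (m + 1 + n) * (k : ℝ) ^ (m + 1)) := by
    rw [Finset.sum_Icc_succ_top (by omega)]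
    simp [binomialRisingSum]
  rw [hext, binomialRisingSum, binomialRisingSum, Finset.sum_div, ← Finset.sum_add_distrib]
  refine Finset.sum_congr rfl fun k hk => ?_
  obtain ⟨hk1, hk2⟩ := Finset.mem_Icc.1 hk
  have hk0 : (k : ℝ) ≠ 0 := by positivity
  have hn0 : (n + 1 : ℝ) ≠ 0 := by positivity
  have h := choose_mul_risingFac_succ n k hk2 x
  rw [← add_assoc (m + 1) n 1, risingFac_succ, show m + (n + 1) = m + 1 + n by ring,
    show x - 1 - m = x - (m + 1 : ℕ) by push_cast; ring,
    show (m : ℝ) - (x - 1) = (m + 1 : ℕ) - x by push_cast; ring,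
    show x - (m + 1 : ℕ) + (m + 1 + n : ℕ) = x + n by push_cast; ring]
  generalize risingFac (x - (m + 1 : ℕ)) (m + 1 + n) = D
  generalize risingFac ((m + 1 : ℕ) - x) k = A
  obtain rfl | hD := eq_or_ne D 0
  · simp
  field_simp
  linear_combination (A * (k : ℝ) ^ m) * h

lemma binomialRisingSum_eq_neg_nestedSumR (m n : ℕ) (hmn : 1 ≤ m ∨ 1 ≤ n) (x : ℝ)
    (hx : ∀ t : ℤ, -(m : ℤ) ≤ t → t ≤ (n : ℤ) - 1 → x + t ≠ 0) :
    binomialRisingSum m n x = - nestedSumR (fun i k => 1 / ((k : ℝ) * (x + k - i))) 1 m n := by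
  induction m generalizing n x with
  | zero =>
    refine binomialRisingSum_zero_left (by simpa using hmn) (risingFac_ne_zero fun j hj => ?_)
    exact_mod_cast hx j (by omega) (by omega)
  | succ m ihm =>
    induction n with
    | zero => simp [binomialRisingSum, nestedSumR]
    | succ n ihn =>
      have hxn : x + n ≠ 0 := by exact_mod_cast hx n (by omega) (by omega)
      rw [binomialRisingSum_succ m n hxn,
        ihn (by omega) fun t h1 h2 => hx t h1 (by omega),
        ihm (n + 1) (by omega) (x - 1) fun t h1 h2 => ?_]
      · simp only [nestedSumR]
        rw [Finset.sum_Icc_succ_top (by omega),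
          nestedSumR_shift (f := fun i k => 1 / ((k : ℝ) * (x + k - i)))
            (g := fun i k => 1 / ((k : ℝ) * (x - 1 + k - i)))
            (fun i k => by push_cast; congr 2; ring) 1 m (n + 1)]
        push_cast
        rw [show x + (n + 1) - 1 = x + n by ring]
        ring
      · have := hx (t - 1) (by push_cast; omega) (by push_cast at h2 ⊢; omega)
        push_cast at this
        rwa [sub_add_eq_add_sub, add_sub_assoc]

theorem stmt_13 (m n : ℕ) (hm : 1 ≤ m) (hn : 1 ≤ n) (x : ℝ)
    (hx : ∀ t : ℤ, -(m : ℤ) ≤ t → t ≤ (n : ℤ) - 1 → x + t ≠ 0) :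
    ∑ k ∈ Finset.Icc 1 n,
        (n.choose k : ℝ) * risingFac ((m : ℝ) - x) k * risingFac x (n - k)
          / (risingFac (x - m) (m + n) * (k : ℝ) ^ m)
      = - nestedSumR (fun i k => 1 / ((k : ℝ) * (x + k - i))) 1 m n := by
  exact binomialRisingSum_eq_neg_nestedSumR m n (Or.inl hm) x hx
end

section
/- Let m, n ≥ 1 be integers. Then ∑_{k=1}^{n} C(n,k) · (k−1)! · (m+n−k−1)! / k^m = ∑_{1 ≤ k_m ≤ k_{m-1} ≤ ⋯ ≤ k_1 ≤ n} (m−1)! · (m+n−1)! / ( k_1·k_2⋯k_m · (k_1+m−1)·(k_2+m−2)⋯(k_m+m−m) ), as an identity of rational numbers, where the multiple sum ranges over all integer tuples (k_1,…,k_m) with 1 ≤ k_m ≤ k_{m-1} ≤ ⋯ ≤ k_1 ≤ n and the last factor in the denominator product is (k_i + m − i) for i = 1,…,m. -/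
open Finset

/-- `nestedSumQ f i r N = ∑_{1 ≤ k_r ≤ ⋯ ≤ k_1 ≤ N} ∏_{s=1}^{r} f (i+s-1) k_s`:
the `r`-fold nested sum `∑_{k_1=1}^{N} f i k_1 ∑_{k_2=1}^{k_1} f (i+1) k_2 ⋯`. -/
def nestedSumQ (f : ℕ → ℕ → ℚ) : ℕ → ℕ → ℕ → ℚ
  | _, 0, _ => 1
  | i, r + 1, N => ∑ k ∈ Finset.Icc 1 N, f i k * nestedSumQ f (i + 1) r k

lemma nestedSumQ_succ_succ (f : ℕ → ℕ → ℚ) (i r N : ℕ) :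
    nestedSumQ f i (r + 1) (N + 1)
      = nestedSumQ f i (r + 1) N + f i (N + 1) * nestedSumQ f (i + 1) r (N + 1) := by
  simp only [nestedSumQ]
  exact Finset.sum_Icc_succ_top (by omega) _

/-- The binomial sum `∑_{k=1}^{N} C(N,k) (k-1)! (r+N-k)! / k^{r+1}`. -/
def binomialFactorialSum (r N : ℕ) : ℚ :=
  ∑ k ∈ Finset.Icc 1 N,
    (N.choose k : ℚ) * ((k - 1).factorial : ℚ) * ((r + N - k).factorial : ℚ) / (k : ℚ) ^ (r + 1)

lemma binomialFactorialSum_eq_sum_Icc_succ (r N : ℕ) :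
    binomialFactorialSum r N = ∑ k ∈ Finset.Icc 1 (N + 1),
      (N.choose k : ℚ) * ((k - 1).factorial : ℚ) * ((r + N - k).factorial : ℚ)
        / (k : ℚ) ^ (r + 1) := by
  rw [Finset.sum_Icc_succ_top (by omega)]
  simp [binomialFactorialSum]

lemma binomialFactorialSum_succ_succ (r N : ℕ) :
    binomialFactorialSum (r + 1) (N + 1) = (r + N + 2) * binomialFactorialSum (r + 1) N
      + (r + 1) / (N + 1) * binomialFactorialSum r (N + 1) := by
  rw [binomialFactorialSum_eq_sum_Icc_succ (r + 1) N, binomialFactorialSum,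
    binomialFactorialSum, Finset.mul_sum, Finset.mul_sum, ← Finset.sum_add_distrib]
  refine Finset.sum_congr rfl fun k hk => ?_
  obtain ⟨hk1, hkN⟩ := Finset.mem_Icc.mp hk
  obtain ⟨d, hd⟩ := Nat.exists_eq_add_of_le hkN
  have hk0 : (k : ℚ) ≠ 0 := by exact_mod_cast (by omega : k ≠ 0)
  have hN0 : (N : ℚ) + 1 ≠ 0 := by positivity
  have hdQ : (N : ℚ) + 1 = k + d := by exact_mod_cast hd
  have hchoose : (N.choose k : ℚ) = (N + 1).choose k * d / (N + 1) := by
    rw [eq_div_iff hN0]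
    have h := Nat.choose_mul_succ_eq N k
    rw [show N + 1 - k = d by omega] at h
    exact_mod_cast h
  rw [show r + 1 + (N + 1) - k = r + d + 1 by omega, show r + 1 + N - k = r + d by omega,
    show r + (N + 1) - k = r + d by omega, Nat.factorial_succ, hchoose]
  have hNQ : (N : ℚ) = k + d - 1 := by linarith
  push_cast
  field_simp
  rw [hNQ]
  ring

lemma binomialFactorialSum_zero_left (N : ℕ) :
    binomialFactorialSum 0 N = N.factorial * ∑ k ∈ Finset.Icc 1 N, 1 / ((k : ℚ) * k) := by
  rw [binomialFactorialSum, Finset.mul_sum]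
  refine Finset.sum_congr rfl fun k hk => ?_
  obtain ⟨hk1, hkN⟩ := Finset.mem_Icc.mp hk
  obtain ⟨j, rfl⟩ := Nat.exists_eq_add_of_le' hk1
  rw [← Nat.choose_mul_factorial_mul_factorial hkN, Nat.factorial_succ]
  simp only [Nat.add_sub_cancel, zero_add, pow_one]
  have : (j : ℚ) + 1 ≠ 0 := by positivity
  push_cast
  field_simp

lemma binomialFactorialSum_eq_nestedSumQ (m r : ℕ) : ∀ i N : ℕ, i + r = m →
    binomialFactorialSum r N = (r.factorial : ℚ) * ((r + N).factorial : ℚ)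
      * nestedSumQ (fun i k => 1 / ((k : ℚ) * ((k : ℚ) + (m : ℚ) - (i : ℚ)))) i (r + 1) N := by
  induction r with
  | zero =>
    rintro i N rfl
    simp [binomialFactorialSum_zero_left, nestedSumQ]
  | succ r ih =>
    intro i N hi
    induction N with
    | zero => simp [binomialFactorialSum, nestedSumQ]
    | succ N ihN =>
      have hm : (m : ℚ) = i + (r + 1) := by exact_mod_cast hi.symm
      have hN0 : (N : ℚ) + 1 ≠ 0 := by positivity
      have hrN : (r : ℚ) + N + 2 ≠ 0 := by positivity
      have hden : ((N + 1 : ℕ) : ℚ) + m - i = r + N + 2 := by rw [hm]; push_cast; ring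
      rw [binomialFactorialSum_succ_succ, ihN, ih (i + 1) (N + 1) (by omega),
        nestedSumQ_succ_succ _ i (r + 1) N, hden,
        show r + 1 + (N + 1) = r + N + 1 + 1 by ring, show r + 1 + N = r + N + 1 by ring,
        show r + (N + 1) = r + N + 1 by ring, Nat.factorial_succ (r + N + 1),
        Nat.factorial_succ r]
      push_cast
      field_simp
      ring

theorem stmt_14 (m n : ℕ) (hm : 1 ≤ m) (hn : 1 ≤ n) :
    ∑ k ∈ Finset.Icc 1 n,
        (n.choose k : ℚ) * ((k - 1).factorial : ℚ) * ((m + n - k - 1).factorial : ℚ)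
          / (k : ℚ) ^ m
      = ((m - 1).factorial : ℚ) * ((m + n - 1).factorial : ℚ)
          * nestedSumQ (fun i k => 1 / ((k : ℚ) * ((k : ℚ) + (m : ℚ) - (i : ℚ)))) 1 m n := by
  obtain ⟨r, rfl⟩ := Nat.exists_eq_add_of_le' hm
  rw [Nat.add_sub_cancel, show r + 1 + n - 1 = r + n by omega,
    ← binomialFactorialSum_eq_nestedSumQ (r + 1) r 1 n (by omega), binomialFactorialSum]
  refine Finset.sum_congr rfl fun k _ => ?_
  rw [show r + 1 + n - k - 1 = r + n - k by omega]
end
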